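/- Let μ ∈ ℝ^n satisfy A(μ) := min_{1≤j≤n} Σ_{i≠j} arctan(μ_i) > A_0 > (n-3)·π/2, and fix C > 0. Then there exist positive constants t_0 and δ_0, depending only on n, μ, A_0 and C, such that for every t ∈ (0, t_0) and every λ ∈ ℝ^n with Σ_i arctan(λ_i) = θ(t) where θ(t) ∈ ((n-2)·π/2 + C t, (n-2)·π/2 + 2 C t), at least one of the following holds: (i) Σ_{i=1}^n (μ_i - λ_i)/(1+λ_i²) ≥ δ_0 · Σ_{i=1}^n 1/(1+λ_i²); or (ii) 1/(1+λ_j²) ≥ δ_0 · Σ_{i=1}^n 1/(1+λ_i²) for all 1 ≤ j ≤ n. -/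

import Mathlib

open Real Finset

/-- The difference `sin² a * (cot b - cot a)`, with the singularity at `sin a = 0` removed. -/
noncomputable def cotDefect (a b : ℝ) : ℝ :=
  sin a ^ 2 * (cos b / sin b) - sin a * cos a

lemma cotDefect_add_le {a₁ a₂ b₁ b₂ : ℝ} (h₁ : 0 < sin b₁) (h₂ : 0 < sin b₂)
    (h : 0 < sin (b₁ + b₂)) :
    cotDefect (a₁ + a₂) (b₁ + b₂) ≤ cotDefect a₁ b₁ + cotDefect a₂ b₂ := by
  set P := sin a₁ * (cos b₁ / sin b₁) - cos a₁ with hP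
  set Q := sin a₂ * (cos b₂ / sin b₂) - cos a₂ with hQ
  have hform : 0 ≤ P ^ 2 + Q ^ 2 - 2 * cos (a₁ + a₂) * P * Q := by
    have := sin_sq_add_cos_sq (a₁ + a₂)
    nlinarith [sq_nonneg (P - cos (a₁ + a₂) * Q), mul_nonneg (sq_nonneg (sin (a₁ + a₂)))
      (sq_nonneg Q)]
  have key : cotDefect a₁ b₁ + cotDefect a₂ b₂ - cotDefect (a₁ + a₂) (b₁ + b₂)
      = (P ^ 2 + Q ^ 2 - 2 * cos (a₁ + a₂) * P * Q) * (sin b₁ * sin b₂ / sin (b₁ + b₂)) := by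
    obtain ⟨p, hp⟩ : ∃ p, p = cos b₁ / sin b₁ := ⟨_, rfl⟩
    obtain ⟨q, hq⟩ : ∃ q, q = cos b₂ / sin b₂ := ⟨_, rfl⟩
    have hsin : sin (b₁ + b₂) = sin b₁ * sin b₂ * (p + q) := by
      rw [sin_add, hp, hq]; field_simp; ring
    have hcos : cos (b₁ + b₂) = sin b₁ * sin b₂ * (p * q - 1) := by
      rw [cos_add, hp, hq]; field_simp
    have hpq : p + q ≠ 0 := by
      rintro h0
      rw [hsin, h0, mul_zero] at h
      exact h.false
    have hcot : cos (b₁ + b₂) / sin (b₁ + b₂) = (p * q - 1) / (p + q) := by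
      rw [hsin, hcos]; field_simp
    have hfac : sin b₁ * sin b₂ / sin (b₁ + b₂) = 1 / (p + q) := by
      rw [hsin]; field_simp
    unfold cotDefect
    rw [hP, hQ, hcot, hfac, ← hp, ← hq, sin_add, cos_add]
    have e₁ := sin_sq_add_cos_sq a₁
    have e₂ := sin_sq_add_cos_sq a₂
    field_simp
    generalize sin a₁ = x at *
    generalize sin a₂ = y at *
    generalize cos a₁ = c at *
    generalize cos a₂ = d at *
    grind
  have : 0 ≤ sin b₁ * sin b₂ / sin (b₁ + b₂) := by positivity
  nlinarith [mul_nonneg hform this]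

lemma cotDefect_sum_le {ι : Type*} (s : Finset ι) (hs : s.Nonempty) (a b : ι → ℝ)
    (hb : ∀ i ∈ s, 0 < b i) (hπ : ∑ i ∈ s, b i < π) :
    cotDefect (∑ i ∈ s, a i) (∑ i ∈ s, b i) ≤ ∑ i ∈ s, cotDefect (a i) (b i) := by
  classical
  induction hs using Finset.Nonempty.cons_induction with
  | singleton i => simp
  | cons i s hi hs ih =>
    simp only [sum_cons, mem_cons, forall_eq_or_imp] at *
    have hpos : 0 < ∑ k ∈ s, b k := sum_pos hb.2 hs
    have := cotDefect_add_le (a₁ := a i) (a₂ := ∑ k ∈ s, a k)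
      (sin_pos_of_pos_of_lt_pi hb.1 (by linarith))
      (sin_pos_of_pos_of_lt_pi hpos (by linarith))
      (sin_pos_of_pos_of_lt_pi (by linarith) hπ)
    linarith [ih hb.2 (by linarith)]

lemma cotDefect_nonneg {a b : ℝ} (hb : 0 < b) (hab : b < a) (ha : a ≤ π) :
    0 ≤ cotDefect a b := by
  have hs : 0 < sin b := sin_pos_of_pos_of_lt_pi hb (by linarith)
  have h : cotDefect a b = sin a * sin (a - b) / sin b := by
    unfold cotDefect
    rw [sin_sub]
    field_simp
  rw [h]
  have h₁ := sin_nonneg_of_nonneg_of_le_pi (hb.trans hab).le ha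
  have h₂ := sin_nonneg_of_nonneg_of_le_pi (sub_nonneg.2 hab.le) (by linarith)
  positivity

lemma cotDefect_arctan (x y : ℝ) :
    cotDefect (π / 2 - arctan x) (π / 2 - arctan y) = (y - x) / (1 + x ^ 2) := by
  have hs : sin (arctan x) = x * cos (arctan x) := by
    have h := tan_arctan x
    rw [tan_eq_sin_div_cos] at h
    field_simp [(cos_arctan_pos x).ne'] at h
    linarith
  unfold cotDefect
  rw [sin_pi_div_two_sub, sin_pi_div_two_sub, cos_pi_div_two_sub, cos_pi_div_two_sub,
    ← tan_eq_sin_div_cos, tan_arctan, hs]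
  have := cos_sq_arctan x
  linear_combination (y - x) * this

/-- Supporting hyperplane inequality for the superlevel sets of `∑ arctan` at levels at least
`(n - 2) * π / 2`. -/
lemma sum_sub_div_one_add_sq_nonneg {n : ℕ} (hn : 0 < n) (lam ν : Fin n → ℝ)
    (hlam : ((n : ℝ) - 2) * π / 2 ≤ ∑ i, arctan (lam i))
    (hν : ∑ i, arctan (lam i) < ∑ i, arctan (ν i)) :
    0 ≤ ∑ i, (ν i - lam i) / (1 + lam i ^ 2) := by
  have : Nonempty (Fin n) := ⟨⟨0, hn⟩⟩
  have hsum (x : Fin n → ℝ) :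
      ∑ i, (π / 2 - arctan (x i)) = n * (π / 2) - ∑ i, arctan (x i) := by
    simp [sum_sub_distrib]
  have hpos (i : Fin n) : 0 < π / 2 - arctan (ν i) := sub_pos.2 (arctan_lt_pi_div_two _)
  have hB : 0 < ∑ i, (π / 2 - arctan (ν i)) := sum_pos (fun i _ => hpos i) univ_nonempty
  have hBA : ∑ i, (π / 2 - arctan (ν i)) < ∑ i, (π / 2 - arctan (lam i)) := by
    rw [hsum, hsum]; linarith
  have hA : ∑ i, (π / 2 - arctan (lam i)) ≤ π := by rw [hsum]; linarith
  calc 0 ≤ _ := cotDefect_nonneg hB hBA hA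
    _ ≤ _ := cotDefect_sum_le univ univ_nonempty _ _ (fun i _ => hpos i) (by linarith)
    _ = _ := sum_congr rfl fun i _ => cotDefect_arctan _ _

theorem stmt_7 (n : ℕ) (hn : 2 ≤ n) (μ : Fin n → ℝ) (A₀ C : ℝ) (hC : 0 < C)
    (hA₀ : ((n : ℝ) - 3) * π / 2 < A₀)
    (hμ : ∀ j : Fin n, A₀ < ∑ i ∈ Finset.univ.erase j, Real.arctan (μ i)) :
    ∃ t₀ > 0, ∃ δ₀ > 0, ∀ t : ℝ, t ∈ Set.Ioo 0 t₀ →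
      ∀ θt : ℝ, θt ∈ Set.Ioo (((n : ℝ) - 2) * π / 2 + C * t)
          (((n : ℝ) - 2) * π / 2 + 2 * C * t) →
        ∀ lam : Fin n → ℝ, (∑ i, Real.arctan (lam i)) = θt →
          (δ₀ * ∑ i, 1 / (1 + (lam i) ^ 2) ≤ ∑ i, (μ i - lam i) / (1 + (lam i) ^ 2)) ∨
          (∀ j : Fin n, δ₀ * ∑ i, 1 / (1 + (lam i) ^ 2) ≤ 1 / (1 + (lam j) ^ 2)) := by
  obtain ⟨g, hg⟩ : ∃ g, g = A₀ - ((n : ℝ) - 3) * π / 2 := ⟨_, rfl⟩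
  have hg0 : 0 < g := by linarith
  obtain ⟨η, hη, hη0⟩ : ∃ η : ℝ,
      (∀ j, A₀ < ∑ i ∈ univ.erase j, arctan (μ i - η)) ∧ 0 < η := by
    have hev : ∀ᶠ η : ℝ in nhds 0, ∀ j, A₀ < ∑ i ∈ univ.erase j, arctan (μ i - η) := by
      refine Filter.eventually_all.2 fun j => ?_
      have hc : Continuous fun η : ℝ => ∑ i ∈ univ.erase j, arctan (μ i - η) := by fun_prop
      exact hc.continuousAt.eventually (lt_mem_nhds (by simpa using hμ j))
    exact ((hev.filter_mono nhdsWithin_le_nhds).and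
      (self_mem_nhdsWithin : Set.Ioi (0 : ℝ) ∈ nhdsWithin 0 (Set.Ioi 0))).exists
  obtain ⟨N, hN⟩ : ∃ N, π / 2 - g / 2 < arctan N :=
    ((tendsto_arctan_atTop.mono_right nhdsWithin_le_nhds).eventually
      (lt_mem_nhds (by linarith))).exists
  obtain ⟨K, hK, hK0⟩ : ∃ K : ℝ, (∀ j, N - μ j + η ≤ K) ∧ 0 ≤ K :=
    ((Filter.eventually_all.2 fun j => Filter.eventually_ge_atTop (N - μ j + η)).and
      (Filter.eventually_ge_atTop 0)).exists
  refine ⟨g / (4 * C), by positivity, η / (K + 1), by positivity, ?_⟩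
  rintro t ⟨ht0, ht⟩ θ ⟨hθ, hθ'⟩ lam hlam
  rw [or_iff_not_imp_right]
  intro h
  push Not at h
  obtain ⟨j, hj⟩ := h
  set W := ∑ i, 1 / (1 + lam i ^ 2)
  rw [lt_div_iff₀ (by positivity)] at ht
  have hCt : 0 < C * t := by positivity
  have hνsum : ∑ i, arctan (Function.update (fun i => μ i - η) j N i)
      = arctan N + ∑ i ∈ univ.erase j, arctan (μ i - η) := by
    rw [← add_sum_erase univ _ (mem_univ j), Function.update_self]
    congr 1
    exact sum_congr rfl fun i hi => by rw [Function.update_of_ne (ne_of_mem_erase hi)]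
  have hsupp := sum_sub_div_one_add_sq_nonneg (by omega) lam
    (Function.update (fun i => μ i - η) j N) (by linarith)
    (by rw [hνsum, hlam]; linarith [hη j])
  have hsplit : ∑ i, (Function.update (fun i => μ i - η) j N i - lam i) / (1 + lam i ^ 2)
      = ∑ i, (μ i - lam i) / (1 + lam i ^ 2) - η * W
        + (N - μ j + η) * (1 / (1 + lam j ^ 2)) := by
    have hterm (i : Fin n) :
        (Function.update (fun i => μ i - η) j N i - lam i) / (1 + lam i ^ 2)
          = (μ i - lam i) / (1 + lam i ^ 2) - η * (1 / (1 + lam i ^ 2))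
            + if i = j then (N - μ j + η) * (1 / (1 + lam j ^ 2)) else 0 := by
      by_cases hij : i = j
      · subst hij
        simp only [Function.update_self, if_true]
        ring
      · simp only [Function.update_of_ne hij, if_neg hij]
        ring
    simp only [hterm, sum_add_distrib, sum_sub_distrib, ← mul_sum, sum_ite_eq', mem_univ,
      if_true, W]
  have hw : (N - μ j + η) * (1 / (1 + lam j ^ 2)) ≤ K * (η / (K + 1) * W) :=
    (mul_le_mul_of_nonneg_right (hK j) (by positivity)).trans
      (mul_le_mul_of_nonneg_left hj.le hK0)
  have hδ : η * W - K * (η / (K + 1) * W) = η / (K + 1) * W := by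
    field_simp
    ring
  linarith
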